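/- Let λ = (λ₁, …, λ_s) be a partition of n with s parts (λ₁ ≥ … ≥ λ_s ≥ 0) such that λ₁ − λ_s ≥ 2s. Then there is a partition ν = (ν₁, …, ν_s) of n obtained from λ by pushing down one or more boxes (i.e. by a finite sequence of single-box push-downs) such that ν₁ = λ₁ − 1 and ν_s < λ_s + s. -/

import Mathlib

open Finset

/-- `μ` is obtained from `l` by pushing down one box: a box is moved from row `i`
to a lower row `j`, all other rows being unchanged. -/
def PushDown {s : ℕ} (l μ : Fin s → ℕ) : Prop :=
  ∃ i j : Fin s, i < j ∧ l i = μ i + 1 ∧ μ j = l j + 1 ∧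
    ∀ k : Fin s, k ≠ i → k ≠ j → μ k = l k

/-- `μ` is obtained from `l` by a finite nonempty sequence of single-box push-downs,
each intermediate step being again a partition (an antitone tuple). -/
def PushDownSeq {s : ℕ} (l μ : Fin s → ℕ) : Prop :=
  Relation.TransGen (fun a b => Antitone b ∧ PushDown a b) l μ

/-- The function `Φ(μ) = ∏ j, (μⱼ/m)^(-μⱼ/m)` (real powers, `0⁰ = 1`). -/
noncomputable def Phi {s : ℕ} (m : ℕ) (μ : Fin s → ℕ) : ℝ :=
  ∏ j : Fin s, ((μ j : ℝ) / m) ^ (-((μ j : ℝ) / m))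

/-- The weight of a partition with at most `t²` parts:
`wt μ = −(μ₁ + ⋯ + μ_{(t²−t)/2}) + (μ_{(t²−t)/2+1} + ⋯ + μ_{t²})`. -/
def wt (t : ℕ) (μ : Fin (t ^ 2) → ℕ) : ℤ :=
  ∑ j : Fin (t ^ 2), if (j : ℕ) < (t ^ 2 - t) / 2 then -(μ j : ℤ) else (μ j : ℤ)

/-- `μ` is the hook partition `h(s,r)`: the first `(t²−t)/2` parts equal `s`,
the remaining `(t²+t)/2` parts equal `r`, and `r < s`. -/
def IsHook (t : ℕ) (μ : Fin (t ^ 2) → ℕ) (s r : ℕ) : Prop :=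
  r < s ∧ ∀ j : Fin (t ^ 2), μ j = if (j : ℕ) < (t ^ 2 - t) / 2 then s else r

theorem PushDown.sum_eq {s : ℕ} {l μ : Fin s → ℕ} (h : PushDown l μ) :
    ∑ k, μ k = ∑ k, l k := by
  obtain ⟨i, j, hij, hi, hj, hk⟩ := h
  have key : ∑ k, (μ k + if k = i then 1 else 0) = ∑ k, (l k + if k = j then 1 else 0) := by
    refine Finset.sum_congr rfl fun k _ => ?_
    rcases eq_or_ne k i with rfl | hki
    · simp [hij.ne, hi]
    · rcases eq_or_ne k j with rfl | hkj
      · simp [hki, hj]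
      · simp [hki, hkj, hk k hki hkj]
  simpa [Finset.sum_add_distrib] using key

theorem PushDownSeq.sum_eq {s : ℕ} {l μ : Fin s → ℕ} (h : PushDownSeq l μ) :
    ∑ k, μ k = ∑ k, l k := by
  induction h with
  | single h => exact h.2.sum_eq
  | tail _ h ih => exact h.2.sum_eq.trans ih

theorem PushDownSeq.antitone {s : ℕ} {l μ : Fin s → ℕ} (h : PushDownSeq l μ) :
    Antitone μ := by
  cases h with
  | single h => exact h.1
  | tail _ h => exact h.1

/-- A box can be pushed from the last row of a block of equal rows to the first row of a lower
block, provided their lengths differ by at least two. -/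
theorem exists_antitone_pushDown {s : ℕ} {l : Fin s → ℕ} (hl : Antitone l) {i j : Fin s}
    (hi : ∀ k, i < k → l k < l i) (hj : ∀ k, k < j → l j < l k) (hij : l j + 2 ≤ l i) :
    ∃ μ : Fin s → ℕ, Antitone μ ∧ PushDown l μ ∧ l i = μ i + 1 ∧ μ j = l j + 1 ∧
      ∀ k, k ≠ i → k ≠ j → μ k = l k := by
  have hlt : i < j := by
    by_contra! h
    have := hl h
    omega
  let μ : Fin s → ℕ := fun k => if k = i then l k - 1 else if k = j then l k + 1 else l k
  have h1 : l i = μ i + 1 := by simp only [μ, if_true]; omega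
  have h2 : μ j = l j + 1 := by simp [μ, hlt.ne']
  have h3 : ∀ k, k ≠ i → k ≠ j → μ k = l k := fun k hki hkj => by simp [μ, hki, hkj]
  refine ⟨μ, fun x y hxy => ?_, ⟨i, j, hlt, h1, h2, h3⟩, h1, h2, h3⟩
  rcases hxy.eq_or_lt with rfl | hxy'
  · exact le_rfl
  have hxl := hl hxy
  have hix := hi y
  have hjx := hj x
  simp only [μ]
  split_ifs <;> subst_vars <;> omega

/-- If rows `0, …, m` are exactly the longest rows, then the first row can be shortened by
pushing down `m + 1` boxes, each step lengthening the last row by at most one. -/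
theorem exists_pushDownSeq_first_row {s : ℕ} (a b : Fin s) (ha : (a : ℕ) = 0)
    (hb : ∀ k, k ≤ b) (m : ℕ) : ∀ (l : Fin s → ℕ) (i : Fin s), Antitone l → (i : ℕ) = m →
      l i = l a → (∀ k, i < k → l k < l i) → l b + m + 2 ≤ l a →
      ∃ ν : Fin s → ℕ, PushDownSeq l ν ∧ l a = ν a + 1 ∧ ν b ≤ l b + m + 1 := by
  induction m with
  | zero =>
    intro l i hl him hia hi hgap
    obtain rfl : i = a := Fin.ext (him.trans ha.symm)
    obtain ⟨j, hj, hjmin⟩ := Finset.exists_min_image (univ.filter fun k => l k = l b) id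
      ⟨b, by simp⟩
    simp only [mem_filter, mem_univ, true_and, id] at hj hjmin
    obtain ⟨μ, hμ, hpush, h1, h2, h3⟩ := exists_antitone_pushDown hl hi
      (j := j) (fun k hk => by
        have := hl (hb k)
        have := mt (hjmin k) hk.not_ge
        omega) (by omega)
    refine ⟨μ, .single ⟨hμ, hpush⟩, h1, ?_⟩
    have := hμ (hb j)
    omega
  | succ m ih =>
    intro l i hl him hia hi hgap
    obtain ⟨j, hj, hjmin⟩ := Finset.exists_min_image (univ.filter fun k => l k = l b) id
      ⟨b, by simp⟩
    simp only [mem_filter, mem_univ, true_and, id] at hj hjmin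
    obtain ⟨μ, hμ, hpush, h1, h2, h3⟩ := exists_antitone_pushDown hl hi
      (j := j) (fun k hk => by
        have := hl (hb k)
        have := mt (hjmin k) hk.not_ge
        omega) (by omega)
    have hμb : μ b ≤ l b + 1 := by
      have := hμ (hb j)
      omega
    have hμa : μ a = l a :=
      h3 a (by rintro rfl; omega) (by rintro rfl; omega)
    let i' : Fin s := ⟨m, by omega⟩
    have hi'i : i' < i := Fin.lt_def.2 (by simp only [i']; omega)
    have hai' : a ≤ i' := Fin.le_def.2 (by omega)
    have hli' : l i' = l a := le_antisymm (hl hai') (hia ▸ hl hi'i.le)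
    have hμi' : μ i' = l a := by
      rw [h3 i' hi'i.ne (by intro h; rw [h] at hli'; omega), hli']
    obtain ⟨ν, hν, hνa, hνb⟩ := ih μ i' hμ rfl (hμi'.trans hμa.symm) (fun k hk => by
        have hik : i ≤ k := Fin.le_def.2 (by
          have : m < (k : ℕ) := hk
          omega)
        have := hμ hik
        omega) (by omega)
    exact ⟨ν, .head ⟨hμ, hpush⟩ hν, by omega, by omega⟩

theorem pushdown_lower_first_row (s n : ℕ) (hs : 0 < s) (l : Fin s → ℕ)
    (hl : Antitone l) (hsum : ∑ j, l j = n)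
    (hgap : l ⟨s - 1, Nat.sub_lt hs one_pos⟩ + 2 * s ≤ l ⟨0, hs⟩) :
    ∃ ν : Fin s → ℕ, Antitone ν ∧ (∑ j, ν j = n) ∧ PushDownSeq l ν ∧
      l ⟨0, hs⟩ = ν ⟨0, hs⟩ + 1 ∧
      ν ⟨s - 1, Nat.sub_lt hs one_pos⟩ < l ⟨s - 1, Nat.sub_lt hs one_pos⟩ + s := by
  set a : Fin s := ⟨0, hs⟩ with ha
  set b : Fin s := ⟨s - 1, Nat.sub_lt hs one_pos⟩ with hb
  have hble : ∀ k, k ≤ b := fun k => Fin.le_def.2 (by simp only [hb]; omega)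
  have hale : ∀ k, a ≤ k := fun k => Fin.le_def.2 (Nat.zero_le _)
  obtain ⟨i, hi, himax⟩ := Finset.exists_max_image (univ.filter fun k => l k = l a) id
    ⟨a, by simp⟩
  simp only [mem_filter, mem_univ, true_and, id] at hi himax
  have hib : (i : ℕ) < s - 1 :=
    Fin.lt_def.1 ((hble i).lt_of_ne (by rintro rfl; omega))
  obtain ⟨ν, hν, hνa, hνb⟩ := exists_pushDownSeq_first_row a b rfl hble i l i hl rfl hi
    (fun k hk => by
      have := hl (hale k)
      have := mt (himax k) hk.not_ge
      omega) (by omega)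
  exact ⟨ν, hν.antitone, hν.sum_eq.trans hsum, hν, hνa, by omega⟩
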